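/- Every totally nonnegative m×n real matrix A belongs to exactly one class M_{r,c}; moreover the unique matrices L ∈ L_r^* and U ∈ U_c with A = LU are themselves totally nonnegative. -/

import Mathlib

open Matrix

/-- A real matrix is totally nonnegative if every minor is nonnegative. -/
def TotNonneg {m n : ℕ} (A : Matrix (Fin m) (Fin n) ℝ) : Prop :=
  ∀ (s : ℕ) (f : Fin s → Fin m) (g : Fin s → Fin n),
    StrictMono f → StrictMono g → 0 ≤ (A.submatrix f g).det

/-- The class `M_{r,c}`. -/
def InM {F : Type} [Field F] {m n t : ℕ} (A : Matrix (Fin m) (Fin n) F)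
    (r : Fin t → Fin m) (c : Fin t → Fin n) : Prop :=
  A.rank = t ∧
  (∀ (s : ℕ) (hs : s ≤ t),
    (A.submatrix (fun k => r (Fin.castLE hs k)) (fun k => c (Fin.castLE hs k))).det ≠ 0) ∧
  (∀ (s : ℕ) (hs : s ≤ t) (f : Fin s → Fin m) (g : Fin s → Fin n),
    StrictMono f → StrictMono g →
    (¬ (∀ k, r (Fin.castLE hs k) ≤ f k) ∨ ¬ (∀ k, c (Fin.castLE hs k) ≤ g k)) →
    (A.submatrix f g).det = 0)

/-- The class `L_r`. -/
def InL {F : Type} [Field F] {m t : ℕ} (L : Matrix (Fin m) (Fin t) F)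
    (r : Fin t → Fin m) : Prop :=
  ∀ j, L (r j) j ≠ 0 ∧ ∀ i, i < r j → L i j = 0

/-- The class `L_r^*`. -/
def InLstar {F : Type} [Field F] {m t : ℕ} (L : Matrix (Fin m) (Fin t) F)
    (r : Fin t → Fin m) : Prop :=
  ∀ j, L (r j) j = 1 ∧ ∀ i, i < r j → L i j = 0

/-- The class `U_c`. -/
def InU {F : Type} [Field F] {t n : ℕ} (U : Matrix (Fin t) (Fin n) F)
    (c : Fin t → Fin n) : Prop :=
  ∀ i, U i (c i) ≠ 0 ∧ ∀ j, j < c i → U i j = 0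


/-- The Cauchy–Binet formula. -/
theorem det_mul_eq_sum_orderEmbedding {s m : ℕ} (A : Matrix (Fin s) (Fin m) ℝ)
    (B : Matrix (Fin m) (Fin s) ℝ) :
    (A * B).det = ∑ K : Fin s ↪o Fin m, (A.submatrix id K).det * (B.submatrix K id).det := by
  have expand : (A * B).det =
      ∑ p : Fin s → Fin m, (A.submatrix id p).det * ∏ i, B (p i) i := by
    simp only [det_apply', mul_apply, Finset.prod_univ_sum, Fintype.piFinset_univ,
      Finset.mul_sum, Finset.sum_mul, Finset.prod_mul_distrib, submatrix_apply, id]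
    rw [Finset.sum_comm]
    exact Finset.sum_congr rfl fun _ _ => Finset.sum_congr rfl fun _ _ => by ring
  have collect : ∀ K : Fin s ↪o Fin m, (A.submatrix id K).det * (B.submatrix K id).det =
      ∑ σ : Equiv.Perm (Fin s), (A.submatrix id (K ∘ σ)).det * ∏ i, B ((K ∘ σ) i) i := by
    intro K
    rw [det_apply' (B.submatrix K id), Finset.mul_sum]
    refine Finset.sum_congr rfl fun σ _ => ?_
    have h := det_permute' σ (A.submatrix id K)
    rw [submatrix_submatrix, Function.id_comp] at h
    rw [h]
    simp only [submatrix_apply, id, Function.comp]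
    ring
  simp_rw [expand, collect]
  rw [← Fintype.sum_prod_type' (f := fun (K : Fin s ↪o Fin m) (σ : Equiv.Perm (Fin s)) =>
    (A.submatrix id (K ∘ σ)).det * ∏ i, B ((K ∘ σ) i) i)]
  symm
  refine Finset.sum_of_injOn (fun x => x.1 ∘ x.2) ?_ (by simp) ?_ (fun _ _ => rfl)
  · rintro ⟨K, σ⟩ - ⟨K', σ'⟩ - h
    have hKK : K = K' := by
      have hr : Set.range K = Set.range K' := by
        rw [← σ.surjective.range_comp K, ← σ'.surjective.range_comp K']
        exact congrArg Set.range h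
      exact DFunLike.coe_injective ((K.strictMono.range_inj K'.strictMono).1 hr)
    subst hKK
    have : σ = σ' := Equiv.ext fun i => K.injective (congrFun h i)
    rw [this]
  · intro p _ hp
    have hinj : ¬ Function.Injective p := by
      intro hpi
      refine hp ⟨⟨OrderEmbedding.ofStrictMono (p ∘ Tuple.sort p)
        ((Tuple.monotone_sort p).strictMono_of_injective
          (hpi.comp (Tuple.sort p).injective)), (Tuple.sort p)⁻¹⟩, by simp, ?_⟩
      ext i
      simp
    obtain ⟨i, j, hij, hne⟩ := Function.not_injective_iff.1 hinj
    rw [det_zero_of_column_eq hne (fun k => by simp [hij]), zero_mul]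

theorem det_eq_zero_of_corner {s : ℕ} (P : Matrix (Fin s) (Fin s) ℝ) (k : Fin s)
    (h : ∀ i j, i ≤ k → k ≤ j → P i j = 0) : P.det = 0 := by
  rw [det_apply']
  refine Finset.sum_eq_zero fun σ _ => ?_
  suffices ∃ j, k ≤ j ∧ σ j ≤ k by
    obtain ⟨j, hj, hσ⟩ := this
    rw [Finset.prod_eq_zero (f := fun i => P (σ i) i) (Finset.mem_univ j) (h _ _ hσ hj), mul_zero]
  by_contra! hc
  have := Finset.card_le_card_of_injOn (s := Finset.Ici k) (t := Finset.Ioi k) σ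
    (fun j hj => by simpa using hc j (by simpa using hj)) σ.injective.injOn
  simp only [Fin.card_Ici, Fin.card_Ioi] at this
  omega

/-- A three-term Plücker relation. -/
theorem det_mul_det_updateCol_updateCol {ι : Type*} [Fintype ι] [DecidableEq ι]
    (P : Matrix ι ι ℝ) (hP : P.det ≠ 0) {p q : ι} (hpq : p ≠ q) (u v : ι → ℝ) :
    P.det * ((P.updateCol p u).updateCol q v).det =
      (P.updateCol p u).det * (P.updateCol q v).det -
        (P.updateCol p v).det * (P.updateCol q u).det := by
  obtain ⟨y, rfl⟩ : ∃ y : ι → ℝ, v = fun k => ∑ i, y i • P k i := by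
    refine ⟨P⁻¹ *ᵥ v, ?_⟩
    have : P *ᵥ (P⁻¹ *ᵥ v) = v := by
      rw [mulVec_mulVec, mul_nonsing_inv _ (isUnit_iff_ne_zero.2 hP), one_mulVec]
    conv_lhs => rw [← this]
    ext k
    simp [mulVec, dotProduct, mul_comm]
  rw [det_updateCol_sum, det_updateCol_sum]
  have key : ∀ i, ((P.updateCol p u).updateCol q fun k => P k i).det =
      (if i = q then (P.updateCol p u).det else 0) -
        if i = p then (P.updateCol q u).det else 0 := by
    intro i
    by_cases hq : i = q
    · subst hq
      rw [if_pos rfl, if_neg hpq.symm, sub_zero]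
      congr 1
      ext a b
      by_cases hb : b = i
      · subst hb; simp [updateCol_ne hpq.symm]
      · simp [updateCol_ne hb]
    by_cases hp : i = p
    · subst hp
      rw [if_neg hq, if_pos rfl, zero_sub]
      have h := det_permute' (Equiv.swap i q) (P.updateCol q u)
      rw [Equiv.Perm.sign_swap hq] at h
      simp only [Units.val_neg, Units.val_one, Int.cast_neg, Int.cast_one, neg_mul, one_mul] at h
      rw [← h]
      congr 1
      ext a b
      by_cases hb : b = q
      · subst hb; simp [updateCol_ne hq]
      by_cases hb' : b = i
      · subst hb'; simp [updateCol_ne hq]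
      · simp [updateCol_ne hb, updateCol_ne hb', Equiv.swap_apply_of_ne_of_ne hb' hb]
    · rw [if_neg hq, if_neg hp, sub_zero]
      refine det_zero_of_column_eq hq fun a => ?_
      simp [updateCol_ne hq, updateCol_ne hp]
  have lin : ((P.updateCol p u).updateCol q fun k => ∑ i, y i • P k i).det =
      ∑ i, y i * ((P.updateCol p u).updateCol q fun k => P k i).det := by
    simp only [← cramer_apply]
    have : (fun k => ∑ i, y i • P k i) = ∑ i, y i • (fun k => P k i) := by
      ext k; simp
    rw [this, map_sum]
    simp
  rw [lin]
  simp only [key, mul_sub, Finset.sum_sub_distrib, mul_ite, mul_zero, Finset.sum_ite_eq',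
    Finset.mem_univ, if_true, smul_eq_mul]
  ring
theorem det_updateCol_single_zero {s : ℕ} (M : Matrix (Fin (s + 1)) (Fin (s + 1)) ℝ)
    (j : Fin (s + 1)) :
    (M.updateCol j (Pi.single 0 1)).det =
      (-1) ^ (j : ℕ) * (M.submatrix Fin.succ j.succAbove).det := by
  have h := adjugate_fin_succ_eq_det_submatrix M j 0
  rw [← transpose_apply M.adjugate 0 j, adjugate_transpose, adjugate_apply, updateRow_transpose,
    det_transpose] at h
  simpa [Fin.succAbove_zero] using h

theorem InL.det_submatrix_eq_zero {m t s : ℕ} {L : Matrix (Fin m) (Fin t) ℝ} {r : Fin t → Fin m}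
    (hr : StrictMono r) (hL : InL L r) {f : Fin s → Fin m} {g : Fin s → Fin t}
    (hf : StrictMono f) (hg : StrictMono g) (h : ¬ ∀ k, r (g k) ≤ f k) :
    (L.submatrix f g).det = 0 := by
  push Not at h
  obtain ⟨k, hk⟩ := h
  exact det_eq_zero_of_corner _ k fun i j hi hj =>
    (hL (g j)).2 _ ((hf.monotone hi).trans_lt (hk.trans_le (hr.monotone (hg.monotone hj))))

theorem strictMono_cons {s m : ℕ} {a : Fin m} {f : Fin s → Fin m} (hf : StrictMono f)
    (ha : ∀ k, a < f k) : StrictMono (Fin.cons a f : Fin (s + 1) → Fin m) := by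
  intro i j hij
  induction i using Fin.cases with
  | zero =>
    induction j using Fin.cases with
    | zero => exact absurd hij (lt_irrefl _)
    | succ j => simpa using ha j
  | succ i =>
    induction j using Fin.cases with
    | zero => exact absurd hij (Fin.not_lt_zero _)
    | succ j => simpa using hf (Fin.succ_lt_succ_iff.1 hij)

theorem strictMono_update_pred {s t : ℕ} {g : Fin (s + 1) → Fin t} (hg : StrictMono g)
    {p : Fin s} {b : Fin t} (hpb : g p.castSucc < b) (hb : b < g p.succ) :
    StrictMono (Function.update g p.succ b) := by
  intro i j hij
  by_cases hi : i = p.succ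
  · subst hi
    rw [Function.update_self, Function.update_of_ne hij.ne']
    exact hb.trans (hg hij)
  · rw [Function.update_of_ne hi]
    by_cases hj : j = p.succ
    · subst hj
      rw [Function.update_self]
      exact (hg.monotone (Fin.le_castSucc_iff.2 hij)).trans_lt hpb
    · rw [Function.update_of_ne hj]
      exact hg hij

theorem strictMono_insertNth_update {s t : ℕ} {g : Fin (s + 1) → Fin t} (hg : StrictMono g)
    {p : Fin s} {b : Fin t} (hpb : g p.castSucc < b) (hb : b < g p.succ) :
    StrictMono (p.succ.insertNth (g p.succ) (Function.update g p.succ b ∘ Fin.succ) :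
      Fin (s + 1) → Fin t) := by
  have hu := strictMono_update_pred hg hpb hb
  intro i j hij
  induction i using Fin.succAboveCases p.succ with
  | x =>
    induction j using Fin.succAboveCases p.succ with
    | x => exact absurd hij (lt_irrefl _)
    | p j =>
      rw [Fin.insertNth_apply_same, Fin.insertNth_apply_succAbove, Function.comp]
      have hlt : p < j := by
        have := Fin.lt_succAbove_iff_le_castSucc p.succ j |>.1 hij
        rw [Fin.le_def, Fin.val_succ, Fin.val_castSucc] at this
        exact Fin.lt_def.2 this
      rw [Function.update_of_ne (by simpa using hlt.ne')]
      exact hg (Fin.succ_lt_succ_iff.2 hlt)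
  | p i =>
    induction j using Fin.succAboveCases p.succ with
    | x =>
      rw [Fin.insertNth_apply_same, Fin.insertNth_apply_succAbove, Function.comp]
      have hle : i ≤ p := by
        have := Fin.succAbove_lt_iff_castSucc_lt p.succ i |>.1 hij
        rw [Fin.lt_def, Fin.val_succ, Fin.val_castSucc] at this
        exact Fin.le_def.2 (Nat.lt_succ_iff.1 this)
      refine (hu.monotone (Fin.succ_le_succ_iff.2 hle)).trans_lt ?_
      rwa [Function.update_self]
    | p j =>
      rw [Fin.insertNth_apply_succAbove, Fin.insertNth_apply_succAbove]
      exact hu (Fin.succ_lt_succ_iff.2 ((Fin.strictMono_succAbove _).lt_iff_lt.1 hij))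

theorem eq_castLE_of_no_gap {s t : ℕ} {g : Fin (s + 1) → Fin (t + 1)} (hg : StrictMono g)
    (h0 : g 0 = 0) (hgap : ∀ p : Fin s, (g p.succ : ℕ) ≤ g p.castSucc + 1)
    (hs : s + 1 ≤ t + 1) : g = Fin.castLE hs := by
  have : ∀ k : Fin (s + 1), (g k : ℕ) = k := by
    intro k
    induction k using Fin.induction with
    | zero => simp [h0]
    | succ p ih =>
      have h1 := hgap p
      have h2 : (g p.castSucc : ℕ) < g p.succ := hg (Fin.castSucc_lt_succ)
      simp only [Fin.val_castSucc, Fin.val_succ] at *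
      omega
  ext k
  simp [this k]

/-- One step of Fekete's argument: the column `g p.succ` is replaced by its gap neighbour `b`. -/
theorem det_pos_of_gap {m t s : ℕ} (L : Matrix (Fin m) (Fin t) ℝ)
    (f : Fin (s + 1) → Fin m) (g : Fin (s + 1) → Fin t) (p : Fin s) (b : Fin t)
    (h1 : 0 < (L.submatrix f (Function.update g p.succ b)).det)
    (h2 : 0 < (L.submatrix (f ∘ Fin.succ) (Function.update g p.succ b ∘ Fin.succ)).det)
    (h3 : 0 < (L.submatrix (f ∘ Fin.succ) (g ∘ Fin.succ)).det)
    (h4 : 0 < (L.submatrix (f ∘ Fin.succ) (g ∘ p.succ.succAbove)).det)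
    (h5 : 0 ≤ (L.submatrix f
      (p.succ.insertNth (g p.succ) (Function.update g p.succ b ∘ Fin.succ) :
        Fin (s + 1) → Fin t)).det) :
    0 < (L.submatrix f g).det := by
  set q := p.succ with hq
  set u := Function.update g q b with hu
  have h0q : (0 : Fin (s + 1)) ≠ q := (Fin.succ_ne_zero p).symm
  have main := det_mul_det_updateCol_updateCol (L.submatrix f u) h1.ne' h0q (Pi.single 0 1)
    (fun k => L (f k) (g q))
  have e1 : (L.submatrix f u).updateCol q (fun k => L (f k) (g q)) = L.submatrix f g := by
    ext i j
    by_cases hj : j = q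
    · subst hj; simp
    · simp [updateCol_ne hj, hu, Function.update_of_ne hj]
  have e2 : ((L.submatrix f u).updateCol 0 (Pi.single 0 1)).det =
      (L.submatrix (f ∘ Fin.succ) (u ∘ Fin.succ)).det := by
    rw [det_updateCol_single_zero]
    simp [Fin.succAbove_zero]
  have e3 : (((L.submatrix f u).updateCol 0 (Pi.single 0 1)).updateCol q
      (fun k => L (f k) (g q))).det = (L.submatrix (f ∘ Fin.succ) (g ∘ Fin.succ)).det := by
    rw [updateCol_comm _ h0q, e1, det_updateCol_single_zero]
    simp [Fin.succAbove_zero]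
  have e4 : ((L.submatrix f u).updateCol q (Pi.single 0 1)).det =
      (-1) ^ (q : ℕ) * (L.submatrix (f ∘ Fin.succ) (g ∘ q.succAbove)).det := by
    rw [det_updateCol_single_zero, submatrix_submatrix]
    congr 3
    ext k
    simp [hu]
  have e5 : (L.submatrix f (q.insertNth (g q) (u ∘ Fin.succ) : Fin (s + 1) → Fin t)).det =
      (-1) ^ (q : ℕ) * ((L.submatrix f u).updateCol 0 (fun k => L (f k) (g q))).det := by
    have h := det_permute' q.cycleRange ((L.submatrix f u).updateCol 0 (fun k => L (f k) (g q)))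
    rw [Fin.sign_cycleRange] at h
    push_cast at h
    rw [← h, ← Fin.cons_comp_cycleRange]
    congr 1
    ext i j
    simp only [submatrix_apply, Function.comp, id]
    generalize q.cycleRange j = k
    induction k using Fin.cases with
    | zero => simp
    | succ k => simp [updateCol_ne]
  rw [e1, e2, e3, e4] at main
  rw [e5] at h5
  have hsq : ((-1 : ℝ) ^ (q : ℕ)) * (-1) ^ (q : ℕ) = 1 := by
    rw [← mul_pow]; norm_num
  set δ := ((L.submatrix f u).updateCol 0 (fun k => L (f k) (g q))).det
  have h6 : 0 ≤ δ * ((-1) ^ (q : ℕ) * (L.submatrix (f ∘ Fin.succ) (g ∘ q.succAbove)).det) := by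
    have := mul_nonneg h5 h4.le
    linarith
  have h7 := mul_pos h1 h3
  exact pos_of_mul_pos_right (by linarith) h2.le

theorem InL.det_pos_of_initial_minors_pos {m t : ℕ} {L : Matrix (Fin m) (Fin t) ℝ}
    {r : Fin t → Fin m} (hr : StrictMono r) (hL : InL L r)
    (h : ∀ (s : ℕ) (hs : s ≤ t) (f : Fin s → Fin m), StrictMono f →
      (∀ k, r (Fin.castLE hs k) ≤ f k) → 0 < (L.submatrix f (Fin.castLE hs)).det)
    {s : ℕ} {f : Fin s → Fin m} {g : Fin s → Fin t} (hf : StrictMono f) (hg : StrictMono g)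
    (hfg : ∀ k, r (g k) ≤ f k) : 0 < (L.submatrix f g).det := by
  induction t generalizing s with
  | zero =>
    obtain rfl : s = 0 := by
      rcases s with _ | s
      · rfl
      · exact (g 0).elim0
    simp
  | succ t ih =>
    have hrow : ∀ j : Fin t, L (r 0) j.succ = 0 := fun j => (hL j.succ).2 _ (hr (Fin.succ_pos j))
    have hpiv : 0 < L (r 0) 0 := by
      have := h 1 (by omega) (fun _ => r 0) (Subsingleton.strictMono _)
        (fun k => by rw [Subsingleton.elim k 0]; rfl)
      simpa using this
    have tail : ∀ (s : ℕ) (f : Fin s → Fin m) (g : Fin s → Fin (t + 1)), StrictMono f →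
        StrictMono g → (∀ k, r (g k) ≤ f k) → (∀ k, g k ≠ 0) → 0 < (L.submatrix f g).det := by
      intro s f g hf hg hfg h0
      have := ih (L := L.submatrix id Fin.succ) (r := r ∘ Fin.succ)
        (hr.comp (Fin.strictMono_succ)) (fun j => hL j.succ) ?_ (g := fun k => (g k).pred (h0 k))
        hf (fun i j hij => Fin.pred_lt_pred_iff.2 (hg hij)) (fun k => by simpa using hfg k)
      · simpa [submatrix_submatrix, Function.comp_def] using this
      · intro s hs f hf hfr
        have hpos := h (s + 1) (by omega) (Fin.cons (r 0) f)
          (strictMono_cons hf fun k => (hr (Fin.succ_pos _)).trans_le (hfr k)) ?_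
        · have expand : (L.submatrix (Fin.cons (r 0) f : Fin (s + 1) → Fin m)
              (Fin.castLE (by omega : s + 1 ≤ t + 1))).det =
              L (r 0) 0 * ((L.submatrix id Fin.succ).submatrix f (Fin.castLE hs)).det := by
            rw [det_succ_row_zero, Fin.sum_univ_succ, Finset.sum_eq_zero]
            · rw [add_zero, submatrix_submatrix, submatrix_submatrix]
              simp only [Fin.val_zero, pow_zero, one_mul]
              rfl
            · intro j _
              have : L (r 0) (Fin.castLE (by omega : s + 1 ≤ t + 1) j.succ) = 0 :=
                hrow (Fin.castLE hs j)
              rw [submatrix_apply, Fin.cons_zero, this, mul_zero, zero_mul]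
          rw [expand] at hpos
          exact pos_of_mul_pos_right hpos hpiv.le
        · intro k
          induction k using Fin.cases with
          | zero => simp
          | succ k => exact hfr k
    generalize hN : ∑ k, (g k : ℕ) = N
    induction N using Nat.strong_induction_on generalizing s with
    | _ N IH =>
    rcases s with _ | s
    · simp
    by_cases h0 : g 0 = 0
    swap
    · refine tail _ f g hf hg hfg fun k hk => h0 ?_
      exact le_antisymm (hk ▸ hg.monotone (Fin.zero_le k)) (Fin.zero_le _)
    by_cases hgap : ∀ p : Fin s, (g p.succ : ℕ) ≤ g p.castSucc + 1
    · have hs : s + 1 ≤ t + 1 := by simpa using Fintype.card_le_of_injective g hg.injective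
      obtain rfl := eq_castLE_of_no_gap hg h0 hgap hs
      exact h _ hs f hf hfg
    push Not at hgap
    obtain ⟨p, hp⟩ := hgap
    obtain ⟨b, hb⟩ : ∃ b : Fin (t + 1), (b : ℕ) + 1 = g p.succ :=
      ⟨⟨g p.succ - 1, by omega⟩, by simp; omega⟩
    have hpb : g p.castSucc < b := by rw [Fin.lt_def]; omega
    have hbq : b < g p.succ := by rw [Fin.lt_def]; omega
    have hu := strictMono_update_pred hg hpb hbq
    have hule : ∀ k, Function.update g p.succ b k ≤ g k := by
      intro k
      by_cases hk : k = p.succ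
      · subst hk; simpa using hbq.le
      · rw [Function.update_of_ne hk]
    have hufg : ∀ k, r (Function.update g p.succ b k) ≤ f k :=
      fun k => (hr.monotone (hule k)).trans (hfg k)
    have hsucc : StrictMono (Fin.succ : Fin s → Fin (s + 1)) := Fin.strictMono_succ
    have hpos : ∀ {g' : Fin (s + 1) → Fin (t + 1)}, StrictMono g' → ∀ k, g' (Fin.succ k) ≠ 0 :=
      fun hg' k => ((Fin.zero_le _).trans_lt (hg' (Fin.succ_pos k))).ne'
    apply det_pos_of_gap L f g p b
    · refine IH _ ?_ hf hu hufg rfl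
      rw [← hN]
      refine Finset.sum_lt_sum (fun k _ => hule k) ⟨p.succ, Finset.mem_univ _, ?_⟩
      simpa using hbq
    · exact tail _ _ _ (hf.comp hsucc) (hu.comp hsucc) (fun k => hufg _) (hpos hu)
    · exact tail _ _ _ (hf.comp hsucc) (hg.comp hsucc) (fun k => hfg _) (hpos hg)
    · refine IH _ ?_ (hf.comp hsucc) (hg.comp (Fin.strictMono_succAbove _)) (fun k => ?_) rfl
      · rw [← hN, Fin.sum_univ_succAbove _ p.succ]
        simp only [Function.comp]
        omega
      · refine (hfg _).trans (hf.monotone ?_)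
        rw [Fin.succAbove]
        split_ifs
        · exact Fin.castSucc_lt_succ.le
        · exact le_rfl
    · set G : Fin (s + 1) → Fin (t + 1) :=
        p.succ.insertNth (g p.succ) (Function.update g p.succ b ∘ Fin.succ) with hG
      have hGm : StrictMono G := strictMono_insertNth_update hg hpb hbq
      by_cases hle : ∀ k, r (G k) ≤ f k
      · refine (tail _ f G hf hGm hle fun k => ?_).le
        induction k using Fin.succAboveCases p.succ with
        | x => rw [hG, Fin.insertNth_apply_same]; exact hpos hg p
        | p k => rw [hG, Fin.insertNth_apply_succAbove]; exact hpos hu k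
      · rw [hL.det_submatrix_eq_zero hr hf hGm hle]

theorem det_choose_pos {s : ℕ} {v : Fin s → ℕ} (hv : StrictMono v) :
    0 < (of fun i j : Fin s => ((v i).choose j : ℝ)).det := by
  have h1 : 0 < (vandermonde fun i => (v i : ℝ)).det := by
    rw [det_vandermonde]
    refine Finset.prod_pos fun i _ => Finset.prod_pos fun j hj => ?_
    exact sub_pos.2 (Nat.cast_lt.2 (hv (Finset.mem_Ioi.1 hj)))
  rw [det_eval_matrixOfPolynomials_eq_det_vandermonde _ (fun j => descPochhammer ℝ j)
    (fun j => descPochhammer_natDegree ℝ j) (fun j => monic_descPochhammer ℝ j)] at h1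
  have h2 := det_mul_row (fun j : Fin s => ((j : ℕ).factorial : ℝ))
    (of fun i j : Fin s => ((v i).choose j : ℝ))
  simp only [descPochhammer_eval_eq_descFactorial, Nat.descFactorial_eq_factorial_mul_choose,
    Nat.cast_mul] at h1
  simp only [of_apply] at h2
  rw [h2] at h1
  exact pos_of_mul_pos_right h1 (Finset.prod_nonneg fun _ _ => Nat.cast_nonneg _)

/-- Scaled Pascal matrices: strictly totally positive among lower triangular matrices for `ε > 0`,
and equal to the identity for `ε = 0`. -/
def scaledPascal (m : ℕ) (ε : ℝ) : Matrix (Fin m) (Fin m) ℝ :=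
  of fun i j => ε ^ ((i : ℕ) - j) * ((i : ℕ).choose j : ℝ)

theorem scaledPascal_eq_zero {m : ℕ} (ε : ℝ) {i j : Fin m} (h : i < j) :
    scaledPascal m ε i j = 0 := by
  simp [scaledPascal, Nat.choose_eq_zero_of_lt (Fin.lt_def.1 h)]

theorem scaledPascal_self {m : ℕ} (ε : ℝ) (i : Fin m) : scaledPascal m ε i i = 1 := by
  simp [scaledPascal]

theorem scaledPascal_zero (m : ℕ) : scaledPascal m 0 = 1 := by
  ext i j
  rcases lt_trichotomy i j with h | rfl | h
  · rw [scaledPascal_eq_zero _ h, one_apply_ne h.ne]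
  · rw [scaledPascal_self, one_apply_eq]
  · have : (i : ℕ) - j ≠ 0 := by have := Fin.lt_def.1 h; omega
    simp [scaledPascal, this, one_apply_ne h.ne']

theorem continuous_scaledPascal (m : ℕ) : Continuous (scaledPascal m) := by
  refine continuous_matrix fun i j => ?_
  simp only [scaledPascal, of_apply]
  fun_prop

theorem scaledPascal_inL (m : ℕ) (ε : ℝ) : InL (scaledPascal m ε) id := fun j =>
  ⟨by simp [scaledPascal_self], fun _ hi => scaledPascal_eq_zero ε hi⟩

theorem scaledPascal_det_pos {m s : ℕ} {ε : ℝ} (hε : 0 < ε) {f g : Fin s → Fin m}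
    (hf : StrictMono f) (hg : StrictMono g) (hfg : ∀ k, g k ≤ f k) :
    0 < ((scaledPascal m ε).submatrix f g).det := by
  refine (scaledPascal_inL m ε).det_pos_of_initial_minors_pos strictMono_id ?_ hf hg hfg
  intro s hs f hf hfs
  have hentry : (scaledPascal m ε).submatrix f (Fin.castLE hs) =
      of fun i j : Fin s => ε ^ (f i : ℕ) *
        (of fun i j : Fin s => (ε ^ (j : ℕ))⁻¹ * ((f i : ℕ).choose j : ℝ)) i j := by
    ext i j
    simp only [scaledPascal, submatrix_apply, of_apply, Fin.val_castLE]
    rcases le_or_gt (j : ℕ) (f i) with h | h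
    · rw [pow_sub₀ _ hε.ne' h, mul_assoc]
    · simp [Nat.choose_eq_zero_of_lt h]
  have h2 := det_mul_row (fun j : Fin s => (ε ^ (j : ℕ))⁻¹)
    (of fun i j : Fin s => ((f i : ℕ).choose j : ℝ))
  simp only [of_apply] at h2
  rw [hentry, det_mul_column, h2]
  have := det_choose_pos (v := fun i => (f i : ℕ)) (fun i j hij => hf hij)
  positivity

theorem scaledPascal_det_nonneg {m s : ℕ} {ε : ℝ} (hε : 0 < ε) {f g : Fin s → Fin m}
    (hf : StrictMono f) (hg : StrictMono g) :
    0 ≤ ((scaledPascal m ε).submatrix f g).det := by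
  by_cases hfg : ∀ k, g k ≤ f k
  · exact (scaledPascal_det_pos hε hf hg hfg).le
  · exact ((scaledPascal_inL m ε).det_submatrix_eq_zero strictMono_id hf hg hfg).ge

theorem InL.scaledPascal_mul {m t : ℕ} {L : Matrix (Fin m) (Fin t) ℝ} {r : Fin t → Fin m}
    (hL : InL L r) (ε : ℝ) : InL (scaledPascal m ε * L) r := by
  refine fun j => ⟨?_, fun i hi => ?_⟩
  · rw [mul_apply, Finset.sum_eq_single (r j), scaledPascal_self, one_mul]
    · exact (hL j).1
    · intro k _ hk
      rcases lt_or_gt_of_ne hk with h | h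
      · rw [(hL j).2 k h, mul_zero]
      · rw [scaledPascal_eq_zero ε h, zero_mul]
    · simp
  · rw [mul_apply]
    refine Finset.sum_eq_zero fun k _ => ?_
    rcases lt_or_ge i k with h | h
    · rw [scaledPascal_eq_zero ε h, zero_mul]
    · rw [(hL j).2 k (h.trans_lt hi), mul_zero]

theorem InL.det_initial_ne_zero {m t : ℕ} {L : Matrix (Fin m) (Fin t) ℝ} {r : Fin t → Fin m}
    (hr : StrictMono r) (hL : InL L r) {s : ℕ} (hs : s ≤ t) :
    (L.submatrix (fun k => r (Fin.castLE hs k)) (Fin.castLE hs)).det ≠ 0 := by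
  rw [det_of_isLowerTriangular]
  · exact Finset.prod_ne_zero_iff.2 fun k _ => (hL _).1
  · exact fun i j hij => (hL _).2 _ (hr hij)

theorem submatrix_mul_submatrix {m n t s s' : ℕ} (L : Matrix (Fin m) (Fin t) ℝ)
    (U : Matrix (Fin t) (Fin n) ℝ) (f : Fin s → Fin m) (g : Fin s' → Fin n) :
    (L * U).submatrix f g = L.submatrix f id * U.submatrix id g :=
  submatrix_mul _ _ _ _ _ Function.bijective_id

/-- A matrix of class `L_r` is totally nonnegative as soon as its minors on initial columns are
nonnegative. -/
theorem InL.totNonneg_of_initial_minors_nonneg {m t : ℕ} {L : Matrix (Fin m) (Fin t) ℝ}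
    {r : Fin t → Fin m} (hr : StrictMono r) (hL : InL L r)
    (h : ∀ (s : ℕ) (hs : s ≤ t) (f : Fin s → Fin m), StrictMono f →
      0 ≤ (L.submatrix f (Fin.castLE hs)).det) : TotNonneg L := by
  have hpos : ∀ ε > 0, ∀ (s : ℕ) (f : Fin s → Fin m) (g : Fin s → Fin t), StrictMono f →
      StrictMono g → 0 ≤ ((scaledPascal m ε * L).submatrix f g).det := by
    intro ε hε s f g hf hg
    have hQ := hL.scaledPascal_mul ε
    by_cases hfg : ∀ k, r (g k) ≤ f k
    swap
    · exact (hQ.det_submatrix_eq_zero hr hf hg hfg).ge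
    refine (hQ.det_pos_of_initial_minors_pos hr ?_ hf hg hfg).le
    intro s hs f hf hfr
    have hrs : StrictMono fun k => r (Fin.castLE hs k) := hr.comp (Fin.strictMono_castLE hs)
    rw [submatrix_mul_submatrix, det_mul_eq_sum_orderEmbedding]
    simp only [submatrix_submatrix, Function.comp_id, Function.id_comp]
    refine Finset.sum_pos' (fun K _ => mul_nonneg
      (scaledPascal_det_nonneg hε hf K.strictMono) (h s hs K K.strictMono))
      ⟨OrderEmbedding.ofStrictMono _ hrs, Finset.mem_univ _, mul_pos ?_ ?_⟩
    · exact scaledPascal_det_pos hε hf hrs hfr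
    · exact lt_of_le_of_ne (h s hs _ hrs) (hL.det_initial_ne_zero hr hs).symm
  intro s f g hf hg
  have hcont : Continuous fun ε => ((scaledPascal m ε * L).submatrix f g).det :=
    (((continuous_scaledPascal m).matrix_mul continuous_const).matrix_submatrix f g).matrix_det
  have hlim := (hcont.tendsto 0).mono_left (nhdsWithin_le_nhds (s := Set.Ioi 0))
  rw [scaledPascal_zero, Matrix.one_mul] at hlim
  exact ge_of_tendsto hlim (eventually_nhdsWithin_of_forall fun ε hε => hpos ε hε s f g hf hg)

theorem InL.submatrix_mul_initial {m n t s : ℕ} {L : Matrix (Fin m) (Fin t) ℝ}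
    {r : Fin t → Fin m} (hr : StrictMono r) (hL : InL L r) (U : Matrix (Fin t) (Fin n) ℝ)
    (hs : s ≤ t) (g : Fin s → Fin n) :
    (L * U).submatrix (fun k => r (Fin.castLE hs k)) g =
      L.submatrix (fun k => r (Fin.castLE hs k)) (Fin.castLE hs) *
        U.submatrix (Fin.castLE hs) g := by
  ext i j
  simp only [submatrix_apply, mul_apply]
  symm
  refine Fintype.sum_of_injective (Fin.castLE hs) (Fin.castLE_injective hs) _ _ ?_ fun _ => rfl
  intro k hk
  have hsk : s ≤ (k : ℕ) := by
    by_contra! hlt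
    exact hk ⟨⟨k, hlt⟩, rfl⟩
  rw [(hL k).2 _ (hr (Fin.lt_def.2 (i.isLt.trans_le hsk))), zero_mul]

theorem InU.submatrix_mul_initial {m n t s : ℕ} {U : Matrix (Fin t) (Fin n) ℝ}
    {c : Fin t → Fin n} (hc : StrictMono c) (hU : InU U c) (L : Matrix (Fin m) (Fin t) ℝ)
    (hs : s ≤ t) (f : Fin s → Fin m) :
    (L * U).submatrix f (fun k => c (Fin.castLE hs k)) =
      L.submatrix f (Fin.castLE hs) *
        U.submatrix (Fin.castLE hs) (fun k => c (Fin.castLE hs k)) := by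
  have h := InL.submatrix_mul_initial (L := Uᵀ) hc hU Lᵀ hs f
  rw [← transpose_mul, ← transpose_submatrix, ← transpose_submatrix, ← transpose_submatrix,
    ← transpose_mul] at h
  exact transpose_injective h

theorem InU.det_initial_ne_zero {n t : ℕ} {U : Matrix (Fin t) (Fin n) ℝ} {c : Fin t → Fin n}
    (hc : StrictMono c) (hU : InU U c) {s : ℕ} (hs : s ≤ t) :
    (U.submatrix (Fin.castLE hs) (fun k => c (Fin.castLE hs k))).det ≠ 0 := by
  have h := InL.det_initial_ne_zero (L := Uᵀ) hc hU hs
  rwa [← transpose_submatrix, det_transpose] at h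

theorem InU.det_submatrix_eq_zero {n t s : ℕ} {U : Matrix (Fin t) (Fin n) ℝ} {c : Fin t → Fin n}
    (hc : StrictMono c) (hU : InU U c) {f : Fin s → Fin n} {g : Fin s → Fin t}
    (hf : StrictMono f) (hg : StrictMono g) (h : ¬ ∀ k, c (g k) ≤ f k) :
    (U.submatrix g f).det = 0 := by
  rw [← det_transpose, transpose_submatrix]
  exact InL.det_submatrix_eq_zero (L := Uᵀ) hc hU hf hg h

theorem castLE_le_of_strictMono {s t : ℕ} (hs : s ≤ t) {K : Fin s → Fin t} (hK : StrictMono K)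
    (k : Fin s) : Fin.castLE hs k ≤ K k := by
  rcases s with _ | s
  · exact k.elim0
  rw [Fin.le_def, Fin.val_castLE]
  induction k using Fin.induction with
  | zero => simp
  | succ k ih =>
    have h : (K k.castSucc : ℕ) < K k.succ := hK Fin.castSucc_lt_succ
    simp only [Fin.val_castSucc, Fin.val_succ] at *
    omega

theorem InL.inM_mul {m n t : ℕ} {L : Matrix (Fin m) (Fin t) ℝ} {U : Matrix (Fin t) (Fin n) ℝ}
    {r : Fin t → Fin m} {c : Fin t → Fin n} (hr : StrictMono r) (hc : StrictMono c)
    (hL : InL L r) (hU : InU U c) : InM (L * U) r c := by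
  have hdet : ∀ (s : ℕ) (hs : s ≤ t), ((L * U).submatrix (fun k => r (Fin.castLE hs k))
      (fun k => c (Fin.castLE hs k))).det ≠ 0 := by
    intro s hs
    rw [hL.submatrix_mul_initial hr, det_mul]
    exact mul_ne_zero (hL.det_initial_ne_zero hr hs) (hU.det_initial_ne_zero hc hs)
  refine ⟨le_antisymm ((rank_mul_le_left L U).trans (rank_le_width L)) ?_, hdet, ?_⟩
  · have h := rank_of_isUnit _ ((isUnit_iff_isUnit_det _).2 (isUnit_iff_ne_zero.2 (hdet t le_rfl)))
    rw [Fintype.card_fin] at h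
    exact h.symm.le.trans (rank_submatrix_le _ _ _)
  · intro s hs f g hf hg hfg
    rw [submatrix_mul_submatrix, det_mul_eq_sum_orderEmbedding]
    refine Finset.sum_eq_zero fun K _ => ?_
    simp only [submatrix_submatrix, Function.comp_id, Function.id_comp]
    have hK := castLE_le_of_strictMono hs K.strictMono
    rcases hfg with h | h
    · rw [hL.det_submatrix_eq_zero hr hf K.strictMono, zero_mul]
      exact fun h' => h fun k => (hr.monotone (hK k)).trans (h' k)
    · rw [hU.det_submatrix_eq_zero hc hg K.strictMono, mul_zero]
      exact fun h' => h fun k => (hc.monotone (hK k)).trans (h' k)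

theorem InLstar.inL {m t : ℕ} {L : Matrix (Fin m) (Fin t) ℝ} {r : Fin t → Fin m}
    (hL : InLstar L r) : InL L r := fun j => ⟨by simp [(hL j).1], (hL j).2⟩

theorem InLstar.totNonneg_factors {m n t : ℕ} {L : Matrix (Fin m) (Fin t) ℝ}
    {U : Matrix (Fin t) (Fin n) ℝ} {r : Fin t → Fin m} {c : Fin t → Fin n} (hr : StrictMono r)
    (hc : StrictMono c) (hL : InLstar L r) (hU : InU U c) (hA : TotNonneg (L * U)) :
    TotNonneg L ∧ TotNonneg U := by
  have hrs : ∀ {s : ℕ} (hs : s ≤ t), StrictMono fun k => r (Fin.castLE hs k) :=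
    fun hs => hr.comp (Fin.strictMono_castLE hs)
  have hcs : ∀ {s : ℕ} (hs : s ≤ t), StrictMono fun k => c (Fin.castLE hs k) :=
    fun hs => hc.comp (Fin.strictMono_castLE hs)
  have hUinit : ∀ (s : ℕ) (hs : s ≤ t) (g : Fin s → Fin n), StrictMono g →
      0 ≤ (U.submatrix (Fin.castLE hs) g).det := by
    intro s hs g hg
    have h := hA s _ g (hrs hs) hg
    rw [hL.inL.submatrix_mul_initial hr, det_mul, det_of_isLowerTriangular, Finset.prod_eq_one,
      one_mul] at h
    · exact h
    · exact fun k _ => (hL _).1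
    · exact fun i j hij => (hL _).2 _ (hr hij)
  constructor
  · refine hL.inL.totNonneg_of_initial_minors_nonneg hr fun s hs f hf => ?_
    have h := hA s f _ hf (hcs hs)
    rw [hU.submatrix_mul_initial hc, det_mul] at h
    exact nonneg_of_mul_nonneg_left h
      (lt_of_le_of_ne (hUinit s hs _ (hcs hs)) (hU.det_initial_ne_zero hc hs).symm)
  · have hUt : TotNonneg Uᵀ :=
      InL.totNonneg_of_initial_minors_nonneg (L := Uᵀ) hc hU fun s hs g hg => by
        rw [← transpose_submatrix, det_transpose]
        exact hUinit s hs g hg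
    intro s f g hf hg
    have h := hUt s g f hg hf
    rwa [← transpose_submatrix, det_transpose] at h

theorem InM.index_le {m n t : ℕ} {A : Matrix (Fin m) (Fin n) ℝ} {r r' : Fin t → Fin m}
    {c c' : Fin t → Fin n} (hr : StrictMono r) (hc : StrictMono c) (h : InM A r c)
    (h' : InM A r' c') : r' ≤ r ∧ c' ≤ c := by
  by_contra hn
  refine h.2.1 t le_rfl (h'.2.2 t le_rfl _ _ hr hc ?_)
  rcases not_and_or.1 hn with h1 | h1
  · exact Or.inl h1
  · exact Or.inr h1

theorem InM.unique {m n t : ℕ} {A : Matrix (Fin m) (Fin n) ℝ} {r r' : Fin t → Fin m}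
    {c c' : Fin t → Fin n} (hr : StrictMono r) (hc : StrictMono c) (hr' : StrictMono r')
    (hc' : StrictMono c') (h : InM A r c) (h' : InM A r' c') : r = r' ∧ c = c' :=
  have h1 := h.index_le hr hc h'
  have h2 := h'.index_le hr' hc' h
  ⟨le_antisymm h2.1 h1.1, le_antisymm h2.2 h1.2⟩

theorem InLstar.factors_unique {m n t : ℕ} {L L' : Matrix (Fin m) (Fin t) ℝ}
    {U U' : Matrix (Fin t) (Fin n) ℝ} {r : Fin t → Fin m} {c : Fin t → Fin n} (hr : StrictMono r)
    (hc : StrictMono c) (hL : InLstar L r) (hU : InU U c) (hL' : InLstar L' r) (hU' : InU U' c)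
    (h : L * U = L' * U') : L = L' ∧ U = U' := by
  have row : ∀ {L : Matrix (Fin m) (Fin t) ℝ} (U : Matrix (Fin t) (Fin n) ℝ), InLstar L r →
      ∀ k j, (L * U) (r k) j = U k j + ∑ l ∈ Finset.Iio k, L (r k) l * U l j := by
    intro L U hL k j
    rw [mul_apply, ← Finset.sum_subset (Finset.subset_univ (Finset.Iic k)), ← Finset.Iio_insert,
      Finset.sum_insert (by simp), (hL k).1, one_mul]
    intro l _ hl
    rw [(hL l).2 _ (hr (by simpa using hl)), zero_mul]
  have col : ∀ (L : Matrix (Fin m) (Fin t) ℝ) {U : Matrix (Fin t) (Fin n) ℝ}, InU U c →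
      ∀ k i, (L * U) i (c k) = L i k * U k (c k) + ∑ l ∈ Finset.Iio k, L i l * U l (c k) := by
    intro L U hU k i
    rw [mul_apply, ← Finset.sum_subset (Finset.subset_univ (Finset.Iic k)), ← Finset.Iio_insert,
      Finset.sum_insert (by simp)]
    intro l _ hl
    rw [(hU l).2 _ (hc (by simpa using hl)), mul_zero]
  have main : ∀ k, (∀ i, L i k = L' i k) ∧ ∀ j, U k j = U' k j := by
    intro k
    induction k using WellFoundedLT.induction with
    | ind k ih =>
    have hUk : ∀ j, U k j = U' k j := by
      intro j
      have e := congrFun (congrFun h (r k)) j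
      rw [row U hL, row U' hL'] at e
      refine add_right_cancel (e.trans (congrArg _ (Finset.sum_congr rfl fun l hl => ?_)))
      have hl' := ih l (Finset.mem_Iio.1 hl)
      rw [hl'.1, hl'.2]
    refine ⟨fun i => ?_, hUk⟩
    have e := congrFun (congrFun h i) (c k)
    rw [col L hU, col L' hU'] at e
    have hs : ∑ l ∈ Finset.Iio k, L i l * U l (c k) =
        ∑ l ∈ Finset.Iio k, L' i l * U' l (c k) := by
      refine Finset.sum_congr rfl fun l hl => ?_
      have hl' := ih l (Finset.mem_Iio.1 hl)
      rw [hl'.1, hl'.2]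
    rw [hs, hUk] at e
    exact mul_right_cancel₀ (hU' k).1 (add_right_cancel e)
  exact ⟨ext fun i k => (main k).1 i, ext fun k j => (main k).2 j⟩

theorem TotNonneg.nonneg {m n : ℕ} {A : Matrix (Fin m) (Fin n) ℝ} (hA : TotNonneg A)
    (i : Fin m) (j : Fin n) : 0 ≤ A i j := by
  simpa using hA 1 (fun _ => i) (fun _ => j) (Subsingleton.strictMono _)
    (Subsingleton.strictMono _)

/-- In a totally nonnegative matrix, the first nonzero row and the first nonzero column meet in a
positive entry. -/
theorem TotNonneg.pivot_pos {m n : ℕ} {A : Matrix (Fin m) (Fin n) ℝ} (hA : TotNonneg A)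
    {p : Fin m} {q : Fin n} (hp : ∀ i < p, ∀ j, A i j = 0) (hq : ∀ j < q, ∀ i, A i j = 0)
    (hp' : ∃ j, A p j ≠ 0) (hq' : ∃ i, A i q ≠ 0) : 0 < A p q := by
  refine lt_of_le_of_ne (hA.nonneg p q) fun h0 => ?_
  obtain ⟨j, hj⟩ := hp'
  obtain ⟨i, hi⟩ := hq'
  have hqj : q < j := by
    rcases lt_trichotomy j q with h | rfl | h
    · exact absurd (hq j h p) hj
    · exact absurd h0.symm hj
    · exact h
  have hpi : p < i := by
    rcases lt_trichotomy i p with h | rfl | h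
    · exact absurd (hp i h q) hi
    · exact absurd h0.symm hi
    · exact h
  have h := hA 2 ![p, i] ![q, j] (by simpa [Fin.strictMono_iff_lt_succ] using hpi)
    (by simpa [Fin.strictMono_iff_lt_succ] using hqj)
  rw [det_fin_two] at h
  simp only [submatrix_apply, cons_val_zero, cons_val_one, ← h0, zero_mul, zero_sub] at h
  have := mul_pos (lt_of_le_of_ne (hA.nonneg p j) hj.symm) (lt_of_le_of_ne (hA.nonneg i q) hi.symm)
  linarith

theorem TotNonneg.schur {m n : ℕ} {A : Matrix (Fin m) (Fin n) ℝ} (hA : TotNonneg A)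
    {p : Fin m} {q : Fin n} (hp : ∀ i < p, ∀ j, A i j = 0) (hq : ∀ j < q, ∀ i, A i j = 0)
    (hpq : 0 < A p q) : TotNonneg (of fun i j => A i j - A i q / A p q * A p j) := by
  set B : Matrix (Fin m) (Fin n) ℝ := of fun i j => A i j - A i q / A p q * A p j with hB
  have hBrow : ∀ i ≤ p, ∀ j, B i j = 0 := by
    intro i hi j
    rcases hi.lt_or_eq with h | rfl
    · simp [hB, hp i h]
    · simp [hB, hpq.ne']
  have hBcol : ∀ j ≤ q, ∀ i, B i j = 0 := by
    intro j hj i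
    rcases hj.lt_or_eq with h | rfl
    · simp [hB, hq j h]
    · simp [hB, hpq.ne']
  intro s f g hf hg
  by_cases hfp : ∃ k, f k ≤ p
  · obtain ⟨k, hk⟩ := hfp
    exact (det_eq_zero_of_row_eq_zero k fun j => hBrow _ hk _).ge
  by_cases hgq : ∃ k, g k ≤ q
  · obtain ⟨k, hk⟩ := hgq
    exact (det_eq_zero_of_column_eq_zero k fun i => hBcol _ hk _).ge
  push Not at hfp hgq
  have h := hA (s + 1) _ _ (strictMono_cons hf hfp) (strictMono_cons hg hgq)
  set C : Matrix (Fin (s + 1)) (Fin (s + 1)) ℝ :=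
    A.submatrix (Fin.cons p f) (Fin.cons q g) with hC
  let D : Matrix (Fin (s + 1)) (Fin (s + 1)) ℝ :=
    of (Fin.cons (C 0) fun i => fun j => B (f i) ((Fin.cons q g : Fin (s + 1) → Fin n) j))
  have hCD : C.det = D.det := by
    refine det_eq_of_forall_row_eq_smul_add_const
      (Fin.cons 0 fun i => A (f i) q / A p q) 0 rfl fun i j => ?_
    induction i using Fin.cases with
    | zero => simp [D]
    | succ i => simp [D, hC, hB]
  have hD : D.det = A p q * (B.submatrix f g).det := by
    rw [det_succ_column_zero, Fin.sum_univ_succ, Finset.sum_eq_zero]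
    · simp only [Fin.val_zero, pow_zero, one_mul, add_zero, Fin.succAbove_zero]
      rfl
    · intro i _
      have : D i.succ 0 = 0 := hBcol q le_rfl (f i)
      rw [this, mul_zero, zero_mul]
  rw [hCD, hD] at h
  exact nonneg_of_mul_nonneg_right h hpq

theorem exists_first_nonzero_row {m n : ℕ} {A : Matrix (Fin m) (Fin n) ℝ} (hA : A ≠ 0) :
    ∃ p, (∀ i < p, ∀ j, A i j = 0) ∧ ∃ j, A p j ≠ 0 := by
  have hne : ∃ p, ∃ j, A p j ≠ 0 := by
    by_contra! h
    exact hA (ext h)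
  obtain ⟨p, hp, hmin⟩ := WellFounded.has_min (wellFounded_lt (α := Fin m)) _ hne
  refine ⟨p, fun i hi j => ?_, hp⟩
  by_contra hij
  exact hmin i ⟨j, hij⟩ hi

theorem TotNonneg.exists_factors {m n : ℕ} {A : Matrix (Fin m) (Fin n) ℝ} (hA : TotNonneg A)
    (a b : ℕ) (ha : ∀ i : Fin m, (i : ℕ) < a → ∀ j, A i j = 0)
    (hb : ∀ j : Fin n, (j : ℕ) < b → ∀ i, A i j = 0) :
    ∃ (t : ℕ) (r : Fin t → Fin m) (c : Fin t → Fin n) (L : Matrix (Fin m) (Fin t) ℝ)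
      (U : Matrix (Fin t) (Fin n) ℝ), StrictMono r ∧ StrictMono c ∧ (∀ k, a ≤ r k) ∧
      (∀ k, b ≤ c k) ∧ InLstar L r ∧ InU U c ∧ A = L * U := by
  induction hd : m - a using Nat.strong_induction_on generalizing A a b with
  | _ d ih =>
  by_cases h0 : A = 0
  · refine ⟨0, Fin.elim0, Fin.elim0, 0, 0, fun k => k.elim0, fun k => k.elim0, fun k => k.elim0,
      fun k => k.elim0, fun k => k.elim0, fun k => k.elim0, ?_⟩
    rw [h0, Matrix.zero_mul]
  obtain ⟨p, hp, hp'⟩ := exists_first_nonzero_row h0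
  obtain ⟨q, hq, hq'⟩ := exists_first_nonzero_row (A := Aᵀ) (by simpa using h0)
  have hpq : 0 < A p q := hA.pivot_pos hp hq hp' hq'
  have hap : a ≤ p := by
    by_contra! h
    exact hpq.ne' (ha p h q)
  have hbq : b ≤ q := by
    by_contra! h
    exact hpq.ne' (hb q h p)
  obtain ⟨t, r, c, L, U, hr, hc, hra, hcb, hL, hU, hLU⟩ := ih (m - (p + 1)) (by omega)
    (hA.schur hp hq hpq) (p + 1) (q + 1)
    (by
      intro i hi j
      rcases (Fin.le_def.2 (Nat.lt_succ_iff.1 hi)).lt_or_eq with h | rfl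
      · simp [hp i h]
      · simp [hpq.ne'])
    (by
      intro j hj i
      rcases (Fin.le_def.2 (Nat.lt_succ_iff.1 hj)).lt_or_eq with h | rfl
      · have h1 : ∀ i, A i j = 0 := hq j h
        simp [h1]
      · simp [hpq.ne']) rfl
  refine ⟨t + 1, Fin.cons p r, Fin.cons q c,
    of fun i => Fin.cons (A i q / A p q) (L i), of (Fin.cons (A p) U),
    strictMono_cons hr hra, strictMono_cons hc hcb, ?_, ?_, ?_, ?_, ?_⟩
  · intro k
    induction k using Fin.cases with
    | zero => simpa using hap
    | succ k => simpa using hap.trans ((Nat.le_succ _).trans (hra k))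
  · intro k
    induction k using Fin.cases with
    | zero => simpa using hbq
    | succ k => simpa using hbq.trans ((Nat.le_succ _).trans (hcb k))
  · intro k
    induction k using Fin.cases with
    | zero => exact ⟨div_self hpq.ne', fun i hi => by simp [hp i hi]⟩
    | succ k => exact hL k
  · intro k
    induction k using Fin.cases with
    | zero => exact ⟨hpq.ne', fun j hj => hq j hj p⟩
    | succ k => exact hU k
  · ext i j
    have h := congrFun (congrFun hLU i) j
    rw [of_apply, mul_apply] at h
    rw [mul_apply, Fin.sum_univ_succ]
    simp only [of_apply, Fin.cons_zero, Fin.cons_succ]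
    change A i j = A i q / A p q * A p j + ∑ l, L i l * U l j
    linarith

theorem tnn_unique_class_and_LU {m n : ℕ} (A : Matrix (Fin m) (Fin n) ℝ)
    (hA : TotNonneg A) :
    (∃ (r : Fin A.rank → Fin m) (c : Fin A.rank → Fin n),
      StrictMono r ∧ StrictMono c ∧ InM A r c) ∧
    (∀ (t t' : ℕ) (r : Fin t → Fin m) (c : Fin t → Fin n)
        (r' : Fin t' → Fin m) (c' : Fin t' → Fin n),
      StrictMono r → StrictMono c → StrictMono r' → StrictMono c' →
      InM A r c → InM A r' c' → t = t' ∧ HEq r r' ∧ HEq c c') ∧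
    (∀ (t : ℕ) (r : Fin t → Fin m) (c : Fin t → Fin n),
      StrictMono r → StrictMono c → InM A r c →
      (∃! LU : Matrix (Fin m) (Fin t) ℝ × Matrix (Fin t) (Fin n) ℝ,
        InLstar LU.1 r ∧ InU LU.2 c ∧ A = LU.1 * LU.2) ∧
      (∀ (L : Matrix (Fin m) (Fin t) ℝ) (U : Matrix (Fin t) (Fin n) ℝ),
        InLstar L r → InU U c → A = L * U → TotNonneg L ∧ TotNonneg U)) := by
  obtain ⟨t₀, r₀, c₀, L₀, U₀, hr₀, hc₀, -, -, hL₀, hU₀, hA₀⟩ := hA.exists_factors 0 0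
    (fun _ h => absurd h (Nat.not_lt_zero _)) (fun _ h => absurd h (Nat.not_lt_zero _))
  have hM₀ : InM A r₀ c₀ := hA₀ ▸ hL₀.inL.inM_mul hr₀ hc₀ hU₀
  refine ⟨?_, ?_, ?_⟩
  · obtain rfl := hM₀.1
    exact ⟨r₀, c₀, hr₀, hc₀, hM₀⟩
  · intro t t' r c r' c' hr hc hr' hc' h h'
    obtain rfl : t = t' := h.1.symm.trans h'.1
    obtain ⟨h1, h2⟩ := h.unique hr hc hr' hc' h'
    exact ⟨rfl, heq_of_eq h1, heq_of_eq h2⟩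
  · intro t r c hr hc h
    obtain rfl : t₀ = t := hM₀.1.symm.trans h.1
    obtain ⟨rfl, rfl⟩ := h.unique hr hc hr₀ hc₀ hM₀
    refine ⟨⟨(L₀, U₀), ⟨hL₀, hU₀, hA₀⟩, ?_⟩, ?_⟩
    · rintro ⟨L, U⟩ ⟨hL, hU, hLU⟩
      obtain ⟨h1, h2⟩ := InLstar.factors_unique hr hc hL hU hL₀ hU₀ (hLU.symm.trans hA₀)
      exact Prod.ext h1 h2
    · intro L U hL hU hLU
      exact hL.totNonneg_factors hr hc hU (hLU ▸ hA)
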